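/- Let G = PSL(2,ℤ) with r, u, S = {r, u, u⁻¹} as above, and let a ∈ {u, u⁻¹}. If g ∈ G satisfies 𝐒₂*(g) = {aa}, then S⁺(g) = {r, a}, 𝐒₂*(g·r) = {ar}, and 𝐒₂*(g·a) = {aa}. -/

import Mathlib

namespace PSL2Z

abbrev SL2Z : Type := Matrix.SpecialLinearGroup (Fin 2) ℤ

/-- `PSL(2,ℤ)`: the quotient of `SL(2,ℤ)` by its center `{±I}`. -/
abbrev G : Type := SL2Z ⧸ Subgroup.center SL2Z

/-- The image in `PSL(2,ℤ)` of the matrix `[[0,1],[-1,0]]`. -/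
def r : G := QuotientGroup.mk (⟨!![0, 1; -1, 0], by norm_num [Matrix.det_fin_two_of]⟩ : SL2Z)

/-- The image in `PSL(2,ℤ)` of the matrix `[[1,1],[0,1]]`. -/
def u : G := QuotientGroup.mk (⟨!![1, 1; 0, 1], by norm_num [Matrix.det_fin_two_of]⟩ : SL2Z)

/-- The symmetric generating set `S = {r, u, u⁻¹}`. -/
def S : Set G := {r, u, u⁻¹}

/-- A word in `S`: a finite list of elements of `S`. -/
def IsWord (w : List G) : Prop := ∀ x ∈ w, x ∈ S

/-- The word norm `|g|`: the least length of a word in `S` representing `g`. -/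
noncomputable def wordNorm (g : G) : ℕ :=
  sInf {n | ∃ w : List G, IsWord w ∧ w.prod = g ∧ w.length = n}

/-- A geodesic for `g`: a word in `S` representing `g` of length `|g|`. -/
def IsGeodesic (g : G) (w : List G) : Prop :=
  IsWord w ∧ w.prod = g ∧ w.length = wordNorm g

/-- `𝐒ₙ(g)`: the set of suffixes of length `n` of geodesics for `g`. -/
def Suf (n : ℕ) (g : G) : Set (List G) :=
  {v | v.length = n ∧ ∃ w : List G, IsGeodesic g w ∧ v <:+ w}

open Classical in
/-- `𝐒₂*(g)`: `𝐒₂(g)` if nonempty, otherwise `𝐒₁(g)` (which is `∅` exactly when `g = 1`). -/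
noncomputable def Suf2Star (g : G) : Set (List G) :=
  if (Suf 2 g).Nonempty then Suf 2 g else Suf 1 g

/-- `S⁺(g) = {s ∈ S : |g·s| = |g| + 1}`. -/
def Splus (g : G) : Set G := {s ∈ S | wordNorm (g * s) = wordNorm g + 1}

/-! ### Invariants of an element of `PSL(2,ℤ)` -/

theorem eq_or_eq_neg_of_inv_mul_mem_center {A B : SL2Z}
    (h : A⁻¹ * B ∈ Subgroup.center SL2Z) : B = A ∨ B = -A := by
  obtain ⟨c, hc, hcA⟩ := Matrix.SpecialLinearGroup.mem_center_iff.mp h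
  have hc' : c = 1 ∨ c = -1 := by simpa using hc
  rcases hc' with rfl | rfl
  · left
    have : A⁻¹ * B = 1 := by ext i j; simp [← hcA]
    exact (inv_mul_eq_one.mp this).symm
  · right
    have : A⁻¹ * B = -1 := by
      ext i j
      rw [← hcA]
      fin_cases i <;> fin_cases j <;> simp
    rw [inv_mul_eq_iff_eq_mul] at this
    simpa using this

/-- Descend an even function of the entries of a matrix to `PSL(2,ℤ)`. -/
def liftEven {X : Type} (f : SL2Z → X) (hf : ∀ A, f (-A) = f A) : G → X :=
  Quotient.lift f fun A B h => by
    rcases eq_or_eq_neg_of_inv_mul_mem_center (QuotientGroup.leftRel_apply.mp h) with rfl | rfl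
    · rfl
    · exact (hf A).symm

/-- The product of the entries of the first column. -/
def colFst : G → ℤ := liftEven (fun A => A 0 0 * A 1 0) (by simp)

/-- The product of the entries of the second column. -/
def colSnd : G → ℤ := liftEven (fun A => A 0 1 * A 1 1) (by simp)

/-- The permanent. -/
def perm : G → ℤ := liftEven (fun A => A 0 0 * A 1 1 + A 0 1 * A 1 0) (by simp)

/-- The sign character of `PSL(2,ℤ) → SL(2,𝔽₂) ≃ S₃`, with values in `ℤ/2`. -/
def parity : G → ZMod 2 :=
  liftEven (fun A => ((A 0 0 * A 0 1 + A 1 0 * A 1 1 + A 0 1 * A 1 0 : ℤ) : ZMod 2)) (by simp)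

theorem mk_neg (A : SL2Z) : (QuotientGroup.mk (-A) : G) = QuotientGroup.mk A := by
  refine QuotientGroup.eq.mpr ?_
  have : (-A)⁻¹ * A = -1 := by simp
  rw [this, Matrix.SpecialLinearGroup.mem_center_iff]
  refine ⟨-1, by simp, ?_⟩
  ext i j
  fin_cases i <;> fin_cases j <;> simp

/-- The class of the matrix `[[a, b], [c, d]]`. -/
def ofEntries (a b c d : ℤ) (h : a * d - b * c = 1) : G :=
  QuotientGroup.mk (⟨!![a, b; c, d], by rw [Matrix.det_fin_two_of, h]⟩ : SL2Z)

theorem exists_ofEntries (g : G) :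
    ∃ (a b c d : ℤ) (h : a * d - b * c = 1), g = ofEntries a b c d h := by
  obtain ⟨A, rfl⟩ := QuotientGroup.mk_surjective g
  refine ⟨A 0 0, A 0 1, A 1 0, A 1 1, ?_, congrArg QuotientGroup.mk ?_⟩
  · have := A.det_coe
    rwa [Matrix.det_fin_two] at this
  · ext i j
    fin_cases i <;> fin_cases j <;> rfl

section Entries

variable {a b c d : ℤ} (h : a * d - b * c = 1)

theorem colFst_ofEntries : colFst (ofEntries a b c d h) = a * c := rfl

theorem colSnd_ofEntries : colSnd (ofEntries a b c d h) = b * d := rfl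

theorem perm_ofEntries : perm (ofEntries a b c d h) = a * d + b * c := rfl

theorem parity_ofEntries :
    parity (ofEntries a b c d h) = ((a * b + c * d + b * c : ℤ) : ZMod 2) := rfl

theorem ofEntries_mul {a' b' c' d' : ℤ} (h' : a' * d' - b' * c' = 1) :
    ofEntries a b c d h * ofEntries a' b' c' d' h' =
      ofEntries (a * a' + b * c') (a * b' + b * d') (c * a' + d * c') (c * b' + d * d')
        (by linear_combination (a' * d' - b' * c') * h + h') := by
  refine congrArg QuotientGroup.mk (Subtype.ext ?_)
  exact Matrix.mul_fin_two ..

theorem r_eq : r = ofEntries 0 1 (-1) 0 (by norm_num) := rfl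

theorem u_eq : u = ofEntries 1 1 0 1 (by norm_num) := rfl

theorem ofEntries_mul_r :
    ofEntries a b c d h * r = ofEntries (-b) a (-d) c (by linarith) := by
  rw [r_eq, ofEntries_mul]
  congr 1 <;> ring

theorem ofEntries_mul_u :
    ofEntries a b c d h * u = ofEntries a (a + b) c (c + d) (by linarith) := by
  rw [u_eq, ofEntries_mul]
  congr 1 <;> ring

theorem ofEntries_neg : ofEntries (-a) (-b) (-c) (-d) (by linarith) = ofEntries a b c d h := by
  refine Eq.trans (congrArg QuotientGroup.mk (Subtype.ext ?_)) (mk_neg _)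
  ext i j
  fin_cases i <;> fin_cases j <;> rfl

theorem ofEntries_one : ofEntries 1 0 0 1 (by norm_num) = 1 := by
  refine congrArg QuotientGroup.mk (Subtype.ext ?_)
  exact Matrix.one_fin_two.symm

end Entries

@[simp] theorem r_mul_r : r * r = 1 := by
  rw [r_eq, ofEntries_mul, ← ofEntries_one, ← ofEntries_neg]
  congr 1

@[simp] theorem r_inv : r⁻¹ = r := inv_eq_of_mul_eq_one_left r_mul_r

@[simp] theorem colFst_one : colFst 1 = 0 := rfl
@[simp] theorem colSnd_one : colSnd 1 = 0 := rfl
@[simp] theorem perm_one : perm 1 = 1 := rfl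
@[simp] theorem parity_one : parity 1 = 0 := rfl

@[simp] theorem colFst_mul_r (g : G) : colFst (g * r) = colSnd g := by
  obtain ⟨a, b, c, d, h, rfl⟩ := exists_ofEntries g
  rw [ofEntries_mul_r, colFst_ofEntries, colSnd_ofEntries]; ring

@[simp] theorem colSnd_mul_r (g : G) : colSnd (g * r) = colFst g := by
  obtain ⟨a, b, c, d, h, rfl⟩ := exists_ofEntries g
  rw [ofEntries_mul_r, colFst_ofEntries, colSnd_ofEntries]

@[simp] theorem perm_mul_r (g : G) : perm (g * r) = -perm g := by
  obtain ⟨a, b, c, d, h, rfl⟩ := exists_ofEntries g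
  rw [ofEntries_mul_r, perm_ofEntries, perm_ofEntries]; ring

@[simp] theorem colFst_mul_u (g : G) : colFst (g * u) = colFst g := by
  obtain ⟨a, b, c, d, h, rfl⟩ := exists_ofEntries g
  rw [ofEntries_mul_u, colFst_ofEntries, colFst_ofEntries]

@[simp] theorem colSnd_mul_u (g : G) : colSnd (g * u) = colFst g + colSnd g + perm g := by
  obtain ⟨a, b, c, d, h, rfl⟩ := exists_ofEntries g
  rw [ofEntries_mul_u, colSnd_ofEntries, colFst_ofEntries, colSnd_ofEntries, perm_ofEntries]; ring

@[simp] theorem perm_mul_u (g : G) : perm (g * u) = perm g + 2 * colFst g := by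
  obtain ⟨a, b, c, d, h, rfl⟩ := exists_ofEntries g
  rw [ofEntries_mul_u, perm_ofEntries, perm_ofEntries, colFst_ofEntries]; ring

@[simp] theorem colFst_mul_u_inv (g : G) : colFst (g * u⁻¹) = colFst g := by
  simpa using (colFst_mul_u (g * u⁻¹)).symm

@[simp] theorem perm_mul_u_inv (g : G) : perm (g * u⁻¹) = perm g - 2 * colFst g := by
  have := perm_mul_u (g * u⁻¹)
  simp only [inv_mul_cancel_right, colFst_mul_u_inv] at this
  linarith

@[simp] theorem colSnd_mul_u_inv (g : G) :
    colSnd (g * u⁻¹) = colFst g + colSnd g - perm g := by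
  have := colSnd_mul_u (g * u⁻¹)
  simp only [inv_mul_cancel_right, colFst_mul_u_inv, perm_mul_u_inv] at this
  linarith

@[simp] theorem colFst_r : colFst r = 0 := by simpa using colFst_mul_r 1
@[simp] theorem colSnd_r : colSnd r = 0 := by simpa using colSnd_mul_r 1
@[simp] theorem perm_r : perm r = -1 := by simpa using perm_mul_r 1
@[simp] theorem colFst_u : colFst u = 0 := by simpa using colFst_mul_u 1
@[simp] theorem colSnd_u : colSnd u = 1 := by simpa using colSnd_mul_u 1
@[simp] theorem perm_u : perm u = 1 := by simpa using perm_mul_u 1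
@[simp] theorem colFst_u_inv : colFst u⁻¹ = 0 := by simpa using colFst_mul_u_inv 1
@[simp] theorem colSnd_u_inv : colSnd u⁻¹ = -1 := by simpa using colSnd_mul_u_inv 1
@[simp] theorem perm_u_inv : perm u⁻¹ = 1 := by simpa using perm_mul_u_inv 1

theorem perm_sq (g : G) : perm g ^ 2 = 1 + 4 * (colFst g * colSnd g) := by
  obtain ⟨a, b, c, d, h, rfl⟩ := exists_ofEntries g
  rw [perm_ofEntries, colFst_ofEntries, colSnd_ofEntries]
  linear_combination (a * d - b * c + 1) * h

theorem eq_one_or_eq_r {g : G} (h₁ : colFst g = 0) (h₂ : colSnd g = 0) : g = 1 ∨ g = r := by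
  obtain ⟨a, b, c, d, h, rfl⟩ := exists_ofEntries g
  rw [colFst_ofEntries] at h₁
  rw [colSnd_ofEntries] at h₂
  rcases mul_eq_zero.mp h₁ with rfl | rfl
  · have hbc : b * (-c) = 1 := by linarith
    have hb : b ≠ 0 := by rintro rfl; simp at hbc
    obtain rfl : d = 0 := (mul_eq_zero.mp h₂).resolve_left hb
    right
    rw [r_eq]
    rcases Int.mul_eq_one_iff_eq_one_or_neg_one.mp hbc with ⟨rfl, hc⟩ | ⟨rfl, hc⟩
    · obtain rfl : c = -1 := by linarith
      rfl
    · obtain rfl : c = 1 := by linarith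
      exact ofEntries_neg (a := 0) (b := 1) (c := -1) (d := 0) _
  · have had : a * d = 1 := by linarith
    have hd : d ≠ 0 := by rintro rfl; simp at had
    obtain rfl : b = 0 := (mul_eq_zero.mp h₂).resolve_right hd
    left
    rw [← ofEntries_one]
    rcases Int.mul_eq_one_iff_eq_one_or_neg_one.mp had with ⟨rfl, rfl⟩ | ⟨rfl, rfl⟩
    · rfl
    · exact ofEntries_neg (a := 1) (b := 0) (c := 0) (d := 1) _

theorem parity_mul_r (g : G) : parity (g * r) = parity g + 1 := by
  obtain ⟨a, b, c, d, h, rfl⟩ := exists_ofEntries g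
  rw [ofEntries_mul_r, parity_ofEntries, parity_ofEntries]
  have h' := congrArg (Int.cast : ℤ → ZMod 2) h
  push_cast at h' ⊢
  generalize (a : ZMod 2) = a, (b : ZMod 2) = b, (c : ZMod 2) = c, (d : ZMod 2) = d at *
  clear h
  revert a b c d
  decide

theorem parity_mul_u (g : G) : parity (g * u) = parity g + 1 := by
  obtain ⟨a, b, c, d, h, rfl⟩ := exists_ofEntries g
  rw [ofEntries_mul_u, parity_ofEntries, parity_ofEntries]
  have h' := congrArg (Int.cast : ℤ → ZMod 2) h
  push_cast at h' ⊢
  generalize (a : ZMod 2) = a, (b : ZMod 2) = b, (c : ZMod 2) = c, (d : ZMod 2) = d at *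
  clear h
  revert a b c d
  decide

theorem parity_mul {s : G} (hs : s ∈ S) (g : G) : parity (g * s) = parity g + 1 := by
  rcases hs with rfl | rfl | rfl
  · exact parity_mul_r g
  · exact parity_mul_u g
  · have h := parity_mul_u (g * u⁻¹)
    rw [inv_mul_cancel_right] at h
    rw [h]
    generalize parity (g * u⁻¹) = x
    revert x
    decide

/-! ### The word norm -/

theorem r_mem_S : r ∈ S := by simp [S]

theorem inv_mem_S {s : G} (hs : s ∈ S) : s⁻¹ ∈ S := by
  rcases hs with rfl | rfl | rfl <;> simp [S]

theorem closure_S : Submonoid.closure S = ⊤ := by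
  have h : Subgroup.closure S = ⊤ := by
    rw [← top_le_iff, ← MonoidHom.range_eq_top.mpr
      (QuotientGroup.mk'_surjective (Subgroup.center SL2Z)), MonoidHom.range_eq_map,
      ← SpecialLinearGroup.SL2Z_generators, MonoidHom.map_closure,
      Subgroup.closure_le]
    rintro _ ⟨A, rfl | rfl, rfl⟩
    · have : (QuotientGroup.mk' (Subgroup.center SL2Z)) ModularGroup.S = r := by
        exact ofEntries_neg (a := 0) (b := 1) (c := -1) (d := 0) (by norm_num)
      rw [this]
      exact Subgroup.subset_closure r_mem_S
    · have : (QuotientGroup.mk' (Subgroup.center SL2Z)) ModularGroup.T = u := rfl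
      rw [this]
      exact Subgroup.subset_closure (by simp [S])
  have hS : S ∪ S⁻¹ = S :=
    Set.union_eq_self_of_subset_right fun s hs => by simpa using inv_mem_S hs
  rw [← hS, ← Subgroup.closure_toSubmonoid, h, Subgroup.top_toSubmonoid]

theorem exists_geodesic (g : G) : ∃ w, IsGeodesic g w := by
  obtain ⟨w, hw, hg⟩ := Submonoid.exists_list_of_mem_closure
    (s := S) (x := g) (by rw [closure_S]; trivial)
  obtain ⟨w', h⟩ := Nat.sInf_mem
    (s := {n | ∃ w : List G, IsWord w ∧ w.prod = g ∧ w.length = n}) ⟨_, w, hw, hg, rfl⟩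
  exact ⟨w', h⟩

theorem wordNorm_prod_le {w : List G} (hw : IsWord w) : wordNorm w.prod ≤ w.length :=
  Nat.sInf_le ⟨w, hw, rfl, rfl⟩

theorem wordNorm_mul_le {s : G} (hs : s ∈ S) (g : G) : wordNorm (g * s) ≤ wordNorm g + 1 := by
  obtain ⟨w, hw, rfl, hl⟩ := exists_geodesic g
  have := wordNorm_prod_le (w := w ++ [s]) (by
    intro x hx
    rcases List.mem_append.mp hx with hx | hx
    · exact hw x hx
    · rwa [List.mem_singleton.mp hx])
  simpa [hl] using this

theorem wordNorm_le_mul {s : G} (hs : s ∈ S) (g : G) : wordNorm g ≤ wordNorm (g * s) + 1 := by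
  simpa using wordNorm_mul_le (inv_mem_S hs) (g * s)

theorem parity_prod {w : List G} (hw : IsWord w) : parity w.prod = w.length := by
  induction w using List.reverseRecOn with
  | nil => simp
  | append_singleton w s ih =>
    rw [List.prod_append, List.prod_singleton, parity_mul (hw s (by simp)),
      ih fun x hx => hw x (by simp [hx])]
    simp

theorem parity_eq_wordNorm (g : G) : parity g = wordNorm g := by
  obtain ⟨w, hw, rfl, hl⟩ := exists_geodesic g
  rw [parity_prod hw, hl]

theorem wordNorm_mul_ne {s : G} (hs : s ∈ S) (g : G) : wordNorm (g * s) ≠ wordNorm g := by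
  intro h
  have := parity_mul hs g
  rw [parity_eq_wordNorm, parity_eq_wordNorm, h] at this
  simp at this

theorem wordNorm_mul_eq {s : G} (hs : s ∈ S) (g : G) :
    wordNorm (g * s) = wordNorm g + 1 ∨ wordNorm (g * s) + 1 = wordNorm g := by
  have := wordNorm_mul_le hs g
  have := wordNorm_le_mul hs g
  have := wordNorm_mul_ne hs g
  omega

theorem wordNorm_pos {g : G} (hg : g ≠ 1) : 0 < wordNorm g := by
  obtain ⟨w, hw, rfl, hl⟩ := exists_geodesic g
  rw [← hl]
  exact List.length_pos_of_ne_nil (by rintro rfl; simp at hg)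

theorem mem_S_of_wordNorm_eq_one {g : G} (hg : wordNorm g = 1) : g ∈ S := by
  obtain ⟨w, hw, rfl, hl⟩ := exists_geodesic g
  obtain ⟨s, rfl⟩ := List.length_eq_one_iff.mp (hl.trans hg)
  simpa using hw s (by simp)

theorem exists_wordNorm_mul_inv {g : G} (hg : 0 < wordNorm g) :
    ∃ s ∈ S, wordNorm (g * s⁻¹) + 1 = wordNorm g := by
  obtain ⟨w, hw, rfl, hl⟩ := exists_geodesic g
  induction w using List.reverseRecOn with
  | nil => simp at hl hg; omega
  | append_singleton w s _ =>
    have hs : s ∈ S := hw s (by simp)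
    refine ⟨s, hs, ?_⟩
    have h₁ := wordNorm_prod_le (w := w) fun x hx => hw x (by simp [hx])
    have h₂ := wordNorm_mul_le hs w.prod
    simp only [List.prod_append, List.prod_singleton, mul_inv_cancel_right,
      List.length_append, List.length_singleton] at hl ⊢
    omega

theorem pair_mem_Suf_two {g s t : G} :
    [s, t] ∈ Suf 2 g ↔ s ∈ S ∧ t ∈ S ∧ wordNorm (g * t⁻¹ * s⁻¹) + 2 = wordNorm g := by
  constructor
  · rintro ⟨-, _, ⟨hw, rfl, hl⟩, w, rfl⟩
    have hs : s ∈ S := hw s (by simp)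
    have ht : t ∈ S := hw t (by simp)
    refine ⟨hs, ht, ?_⟩
    have h₁ := wordNorm_prod_le (w := w) fun x hx => hw x (by simp [hx])
    have h₂ := wordNorm_mul_le hs w.prod
    have h₃ := wordNorm_mul_le ht (w.prod * s)
    have hp : (w ++ [s, t]).prod = w.prod * s * t := by simp [mul_assoc]
    rw [hp] at hl ⊢
    simp only [mul_inv_cancel_right, List.length_append, List.length_cons,
      List.length_nil] at hl ⊢
    omega
  · rintro ⟨hs, ht, h⟩
    obtain ⟨w, hw, hp, hl⟩ := exists_geodesic (g * t⁻¹ * s⁻¹)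
    refine ⟨rfl, w ++ [s, t], ⟨?_, ?_, ?_⟩, List.suffix_append _ _⟩
    · intro x hx
      simp only [List.mem_append, List.mem_cons, List.not_mem_nil, or_false] at hx
      rcases hx with hx | rfl | rfl
      exacts [hw x hx, hs, ht]
    · rw [List.prod_append, hp]
      simp [mul_assoc]
    · simp [hl, h]

theorem Suf_two_eq_singleton_iff {g a b : G} : Suf 2 g = {[a, b]} ↔
    ∀ s t, [s, t] ∈ Suf 2 g ↔ s = a ∧ t = b := by
  constructor
  · intro h s t
    simp [h]
  · intro h
    ext v
    constructor
    · intro hv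
      obtain ⟨s, t, rfl⟩ := List.length_eq_two.mp hv.1
      obtain ⟨rfl, rfl⟩ := (h s t).mp hv
      rfl
    · rintro rfl
      exact (h a b).mpr ⟨rfl, rfl⟩

theorem Suf2Star_eq_pair_iff {g a b : G} : Suf2Star g = {[a, b]} ↔ Suf 2 g = {[a, b]} := by
  unfold Suf2Star
  split_ifs with hne
  · rfl
  · constructor
    · intro h
      have hm : [a, b] ∈ Suf 1 g := by rw [h]; rfl
      simpa using hm.1
    · intro h
      exact absurd (by rw [h]; simp) hne

/-! ### The two sides of an edge labelled `r` -/

/-- The edge `{1, r}` of the Cayley graph separates it into two sides, indexed by a sign `ε`;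
both contain the edge itself. -/
def Side (ε : ℤ) (g : G) : Prop := 0 ≤ ε * colFst g ∧ 0 ≤ ε * colSnd g

theorem colFst_mul_colSnd_nonneg (g : G) : 0 ≤ colFst g * colSnd g := by
  have := perm_sq g
  have := sq_nonneg (perm g)
  omega

theorem side_or_side_neg (ε : ℤ) (g : G) : Side ε g ∨ Side (-ε) g := by
  have h := colFst_mul_colSnd_nonneg g
  unfold Side
  rcases mul_nonneg_iff.mp h with ⟨h₁, h₂⟩ | ⟨h₁, h₂⟩ <;> rcases le_total 0 ε with h₃ | h₃
  · left; constructor <;> nlinarith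
  · right; constructor <;> nlinarith
  · right; constructor <;> nlinarith
  · left; constructor <;> nlinarith

theorem Side.eq_one_or_eq_r {ε : ℤ} (hε : ε = 1 ∨ ε = -1) {g : G} (h : Side ε g)
    (h' : Side (-ε) g) : g = 1 ∨ g = r := by
  obtain ⟨h₁, h₂⟩ := h
  obtain ⟨h₃, h₄⟩ := h'
  apply PSL2Z.eq_one_or_eq_r <;> rcases hε with rfl | rfl <;> omega

theorem abs_perm_le {g : G} (h₁ : g ≠ 1) (h₂ : g ≠ r) :
    |perm g| ≤ |colFst g + colSnd g| := by
  rw [← sq_le_sq]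
  have hp := perm_sq g
  have hne : colFst g ≠ colSnd g := by
    intro he
    rw [← he] at hp
    have h0 : colFst g = 0 := by
      by_contra h0
      have h1 : 1 ≤ |colFst g| := Int.one_le_abs h0
      have h2 : |perm g| ^ 2 = 1 + 4 * (|colFst g| * |colFst g|) := by
        rw [sq_abs, abs_mul_abs_self, hp]
      have h3 := abs_nonneg (perm g)
      have h4 : 2 * |colFst g| < |perm g| := by nlinarith
      nlinarith
    rcases eq_one_or_eq_r h0 (he ▸ h0) with h | h
    exacts [h₁ h, h₂ h]
  have h1 : 1 ≤ |colFst g - colSnd g| := Int.one_le_abs (sub_ne_zero.mpr hne)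
  have h2 := sq_abs (colFst g - colSnd g)
  nlinarith

theorem Side.mul {ε : ℤ} (hε : ε = 1 ∨ ε = -1) {g s : G} (h : Side ε g) (h₁ : g ≠ 1)
    (h₂ : g ≠ r) (hs : s ∈ S) : Side ε (g * s) := by
  have hp := abs_perm_le h₁ h₂
  obtain ⟨h₃, h₄⟩ := h
  have hp' : |perm g| ≤ ε * (colFst g + colSnd g) := by
    refine hp.trans (le_of_eq ?_)
    rcases hε with rfl | rfl
    · rw [abs_of_nonneg (by linarith)]; ring
    · rw [abs_of_nonpos (by linarith)]; ring
  obtain ⟨h₅, h₆⟩ := abs_le.mp hp'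
  rcases hs with rfl | rfl | rfl
  · simpa [Side] using ⟨h₄, h₃⟩
  · refine ⟨by simpa using h₃, ?_⟩
    rw [colSnd_mul_u]
    rcases hε with rfl | rfl <;> linarith
  · refine ⟨by simpa using h₃, ?_⟩
    rw [colSnd_mul_u_inv]
    rcases hε with rfl | rfl <;> linarith

/-- A word leading from one side of the edge `{k, kr}` to the other meets this edge. -/
theorem exists_split {ε : ℤ} (hε : ε = 1 ∨ ε = -1) {k : G} (hk : Side (-ε) k⁻¹) {w : List G}
    (hw : IsWord w) (h : Side ε (k⁻¹ * w.prod)) :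
    ∃ w₁ w₂, w = w₁ ++ w₂ ∧ (k⁻¹ * w₁.prod = 1 ∨ k⁻¹ * w₁.prod = r) := by
  induction w using List.reverseRecOn with
  | nil =>
    refine ⟨[], [], rfl, ?_⟩
    have h' : Side ε (k⁻¹) := by simpa using h
    simpa using h'.eq_one_or_eq_r hε hk
  | append_singleton w s ih =>
    by_cases hy : k⁻¹ * (w ++ [s]).prod = 1 ∨ k⁻¹ * (w ++ [s]).prod = r
    · exact ⟨w ++ [s], [], by simp, hy⟩
    · push Not at hy
      have := h.mul hε hy.1 hy.2 (inv_mem_S (hw s (by simp)))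
      obtain ⟨w₁, w₂, rfl, h'⟩ := ih (fun x hx => hw x (by simp [hx]))
        (by simpa [mul_assoc] using this)
      exact ⟨w₁, w₂ ++ [s], by simp, h'⟩

theorem wordNorm_le_of_side {ε : ℤ} (hε : ε = 1 ∨ ε = -1) {k y : G} (hk : Side (-ε) k⁻¹)
    (hy : Side ε y) :
    wordNorm k + wordNorm y ≤ wordNorm (k * y) ∨
      wordNorm (k * r) + wordNorm (r * y) ≤ wordNorm (k * y) := by
  obtain ⟨w, hw, hp, hl⟩ := exists_geodesic (k * y)
  obtain ⟨w₁, w₂, rfl, h⟩ := exists_split hε hk hw (by simpa [hp] using hy)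
  have h₁ := wordNorm_prod_le (w := w₁) fun x hx => hw x (by simp [hx])
  have h₂ := wordNorm_prod_le (w := w₂) fun x hx => hw x (by simp [hx])
  rw [List.prod_append] at hp
  rw [List.length_append] at hl
  rcases h with h | h
  · left
    obtain rfl := inv_mul_eq_one.mp h
    rw [mul_left_cancel hp] at h₂
    omega
  · right
    rw [inv_mul_eq_iff_eq_mul] at h
    have : w₂.prod = r * y := by
      rw [h, mul_assoc] at hp
      rw [← mul_left_cancel hp, ← mul_assoc, r_mul_r, one_mul]
    rw [h] at h₁
    rw [this] at h₂
    omega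

theorem side_inv_of_wordNorm_lt {ε : ℤ} (hε : ε = 1 ∨ ε = -1) {k y : G} (hy : Side (-ε) y)
    (h₁ : wordNorm (k * y) < wordNorm k) (h₂ : wordNorm (k * y) < wordNorm (k * r)) :
    Side (-ε) k⁻¹ := by
  refine (side_or_side_neg ε k⁻¹).resolve_left fun hk => ?_
  rcases wordNorm_le_of_side (ε := -ε) (by omega) (by simpa using hk) hy with h | h <;> omega

theorem ne_of_colFst_ne {g h : G} (hne : colFst g ≠ colFst h) : g ≠ h := fun he => hne (he ▸ rfl)

theorem ne_of_colSnd_ne {g h : G} (hne : colSnd g ≠ colSnd h) : g ≠ h := fun he => hne (he ▸ rfl)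

theorem ne_of_mem {a : G} (ha : a ∈ ({u, u⁻¹} : Set G)) : a ≠ r ∧ a⁻¹ ≠ a := by
  rcases ha with rfl | rfl
  · exact ⟨ne_of_colSnd_ne (by simp), ne_of_colSnd_ne (by simp)⟩
  · exact ⟨ne_of_colSnd_ne (by simp), ne_of_colSnd_ne (by simp)⟩

theorem S_eq {a : G} (ha : a ∈ ({u, u⁻¹} : Set G)) : S = {r, a, a⁻¹} := by
  rcases ha with rfl | rfl
  · rfl
  · rw [S, inv_inv, Set.pair_comm]

/-- Word norms beyond an element `g` all of whose geodesics end in `aa`. -/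
theorem wordNorm_beyond {a g : G} (ha : a ∈ ({u, u⁻¹} : Set G))
    (h₁ : wordNorm (g * a⁻¹) < wordNorm g)
    (h₂ : wordNorm (g * a⁻¹ * a⁻¹) < wordNorm (g * a⁻¹))
    (hr : wordNorm g < wordNorm (g * r))
    (hr' : wordNorm (g * a⁻¹) < wordNorm (g * a⁻¹ * r)) :
    wordNorm g < wordNorm (g * a * r) ∧ wordNorm g < wordNorm (g * a * a) ∧
      wordNorm g < wordNorm (g * r * a) ∧ wordNorm g < wordNorm (g * r * a⁻¹) := by
  obtain ⟨ε, hε, hinv, har, haa, hra, hara, nar, naa, nra, nara, nrara⟩ :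
      ∃ ε : ℤ, (ε = 1 ∨ ε = -1) ∧ Side (-ε) a⁻¹ ∧ Side ε (a * r) ∧ Side ε (a * a) ∧
        Side ε (r * a⁻¹) ∧ Side ε (a * r * a) ∧ a * r ≠ 1 ∧ a * a ≠ 1 ∧ r * a⁻¹ ≠ 1 ∧
        (a * r * a ≠ 1 ∧ a * r * a ∉ S) ∧ r * a * r * a ≠ 1 := by
    rcases ha with rfl | rfl
    · refine ⟨1, Or.inl rfl, by simp [Side], by simp [Side], by simp [Side], by simp [Side],
        by simp [Side], ne_of_colFst_ne (by simp), ne_of_colSnd_ne (by simp),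
        ne_of_colSnd_ne (by simp), ⟨ne_of_colFst_ne (by simp), ?_⟩, ne_of_colFst_ne (by simp)⟩
      rintro (h | h | h) <;> exact ne_of_colFst_ne (by simp) h
    · refine ⟨-1, Or.inr rfl, by simp [Side], by simp [Side], by simp [Side], by simp [Side],
        by simp [Side], ne_of_colFst_ne (by simp), ne_of_colSnd_ne (by simp),
        ne_of_colSnd_ne (by simp), ⟨ne_of_colFst_ne (by simp), ?_⟩, ne_of_colFst_ne (by simp)⟩
      rintro (h | h | h) <;> exact ne_of_colFst_ne (by simp) h
  have hg : Side (-ε) g⁻¹ := side_inv_of_wordNorm_lt hε hinv h₁ (h₁.trans hr)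
  have hga : Side (-ε) (g * a⁻¹)⁻¹ := side_inv_of_wordNorm_lt hε hinv h₂ (h₂.trans hr')
  have key : ∀ y, Side ε y → y ≠ 1 → wordNorm g < wordNorm (g * y) := fun y hy hne => by
    have := wordNorm_pos hne
    rcases wordNorm_le_of_side hε hg hy with h | h <;> omega
  refine ⟨mul_assoc g a r ▸ key _ har nar, mul_assoc g a a ▸ key _ haa naa, ?_,
    mul_assoc g r a⁻¹ ▸ key _ hra nra⟩
  have hs : wordNorm g ≤ wordNorm (g * a⁻¹) + 1 :=
    wordNorm_le_mul (s := a⁻¹) (by rw [S_eq ha]; simp) g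
  have hs' : wordNorm g ≤ wordNorm (g * a⁻¹ * r) := by omega
  have e : g * a⁻¹ * (a * r * a) = g * r * a := by group
  have n₁ := wordNorm_pos nara.1
  have n₂ : wordNorm (a * r * a) ≠ 1 := fun h => nara.2 (mem_S_of_wordNorm_eq_one h)
  have n₃ : 0 < wordNorm (r * (a * r * a)) := wordNorm_pos (by simpa [mul_assoc] using nrara)
  rcases wordNorm_le_of_side hε hga hara with h | h <;> rw [e] at h <;> omega

/-- If `𝐒₂*(g) = {aa}` (for `a = u` or `u⁻¹`) then `S⁺(g) = {r, a}`,
`𝐒₂*(g·r) = {ar}` and `𝐒₂*(g·a) = {aa}`. -/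
theorem type_aa (a : G) (ha : a ∈ ({u, u⁻¹} : Set G))
    (g : G) (hg : Suf2Star g = ({[a, a]} : Set (List G))) :
    Splus g = {r, a} ∧
      Suf2Star (g * r) = {[a, r]} ∧
      Suf2Star (g * a) = {[a, a]} := by
  rw [Suf2Star_eq_pair_iff] at hg ⊢
  rw [Suf2Star_eq_pair_iff]
  rw [Suf_two_eq_singleton_iff] at hg
  have hS := S_eq ha
  have haS : a ∈ S := by simp [hS]
  have haS' := inv_mem_S haS
  obtain ⟨har, haa⟩ := ne_of_mem ha
  have h0 := (pair_mem_Suf_two.mp ((hg a a).mpr ⟨rfl, rfl⟩)).2.2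
  have last : ∀ s ∈ S, wordNorm (g * s⁻¹) + 1 = wordNorm g → s = a := by
    intro s hs h
    obtain ⟨t, ht, h'⟩ := exists_wordNorm_mul_inv (g := g * s⁻¹) (by omega)
    exact ((hg t s).mp (pair_mem_Suf_two.mpr ⟨ht, hs, by omega⟩)).2
  have h₁ := wordNorm_le_mul haS' g
  have h₂ := wordNorm_le_mul haS' (g * a⁻¹)
  have hr : wordNorm (g * r) = wordNorm g + 1 :=
    (wordNorm_mul_eq r_mem_S g).resolve_right fun h => har (last r r_mem_S (by simpa using h)).symm
  have hga : wordNorm (g * a) = wordNorm g + 1 :=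
    (wordNorm_mul_eq haS g).resolve_right fun h => haa (last a⁻¹ haS' (by simpa using h))
  have hr' : wordNorm (g * a⁻¹ * r) = wordNorm (g * a⁻¹) + 1 :=
    (wordNorm_mul_eq r_mem_S _).resolve_right fun h =>
      har ((hg r a).mp (pair_mem_Suf_two.mpr ⟨r_mem_S, haS, by rw [r_inv]; omega⟩)).1.symm
  obtain ⟨b₁, b₂, b₃, b₄⟩ :=
    wordNorm_beyond (g := g) ha (by omega) (by omega) (by omega) (by omega)
  refine ⟨?_, ?_, ?_⟩
  · ext s
    simp only [Splus, Set.mem_ofPred_eq, hS, Set.mem_insert_iff, Set.mem_singleton_iff]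
    constructor
    · rintro ⟨rfl | rfl | rfl, h⟩
      · simp
      · simp
      · omega
    · rintro (rfl | rfl)
      · exact ⟨Or.inl rfl, hr⟩
      · exact ⟨Or.inr (Or.inl rfl), hga⟩
  · rw [Suf_two_eq_singleton_iff]
    intro s t
    rw [pair_mem_Suf_two]
    constructor
    · rintro ⟨hs, ht, h⟩
      have h₃ := wordNorm_le_mul (inv_mem_S hs) (g * r * t⁻¹)
      rw [hS] at ht
      rcases ht with rfl | rfl | rfl
      · rw [mul_inv_cancel_right] at h
        exact ⟨last s hs (by omega), rfl⟩
      · omega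
      · rw [inv_inv] at h h₃
        omega
    · rintro ⟨rfl, rfl⟩
      refine ⟨haS, r_mem_S, ?_⟩
      rw [mul_inv_cancel_right]
      omega
  · rw [Suf_two_eq_singleton_iff]
    intro s t
    rw [pair_mem_Suf_two]
    constructor
    · rintro ⟨hs, ht, h⟩
      have h₃ := wordNorm_le_mul (inv_mem_S hs) (g * a * t⁻¹)
      rw [hS] at ht
      rcases ht with rfl | rfl | rfl
      · rw [r_inv] at h h₃
        omega
      · rw [mul_inv_cancel_right] at h
        exact ⟨last s hs (by omega), rfl⟩
      · rw [inv_inv] at h h₃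
        omega
    · rintro ⟨rfl, rfl⟩
      refine ⟨haS, haS, ?_⟩
      rw [mul_inv_cancel_right]
      omega

end PSL2Z
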